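/- arXiv:2502.10485 — 2 statements merged into one kernel-verified Lean document; each statement's English description precedes it below -/
import Mathlib

section
/- Assume Λ and M are injective and let λ ≥ 0. Let C be any complex p×D matrix and let θ* ∈ ℂ^D satisfy Cθ* = 0, and let Yⱼ ∈ ℂ^{d₂} be arbitrary (e.g. Yⱼ = Φⱼθ* + εⱼ with arbitrary noise εⱼ). Define the unconstrained estimator θ̂ = (Σⱼ Φⱼ*Λ*ΛΦⱼ + n·M*M)^{-1} Σⱼ Φⱼ*Λ*ΛYⱼ and the constrained estimator θ̂_C = (Σⱼ Φⱼ*Λ*ΛΦⱼ + n·M*M + λn·C*C)^{-1} Σⱼ Φⱼ*Λ*ΛYⱼ. Then (1/n)·Σ_{j=1}^n ‖ΛΦⱼ(θ* − θ̂_C)‖₂² + ‖M(θ* − θ̂_C)‖₂² ≤ (1/n)·Σ_{j=1}^n ‖ΛΦⱼ(θ* − θ̂)‖₂² + ‖M(θ* − θ̂)‖₂². -/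
open Matrix

/-- Squared Euclidean norm on `ℂ^d`. -/
noncomputable def sqnorm {d : ℕ} (x : Fin d → ℂ) : ℝ := ∑ i, ‖x i‖ ^ 2

theorem star_dotProduct_self_eq_sqnorm {d : ℕ} (x : Fin d → ℂ) :
    star x ⬝ᵥ x = (sqnorm x : ℂ) := by
  simp [dotProduct, sqnorm, ← Complex.conj_mul']

theorem star_dotProduct_conjTranspose_mul_self_mulVec {m d : ℕ} (K : Matrix (Fin m) (Fin d) ℂ)
    (x : Fin d → ℂ) : star x ⬝ᵥ (Kᴴ * K) *ᵥ x = (sqnorm (K *ᵥ x) : ℂ) := by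
  rw [← star_dotProduct_self_eq_sqnorm, ← mulVec_mulVec, dotProduct_mulVec, star_mulVec]

open scoped ComplexOrder in
/-- If `A x = (A + B) y` with `A`, `B` positive semidefinite, then the quadratic form of `A`
at `y` is at most its value at `x`. -/
theorem Matrix.PosSemidef.dotProduct_mulVec_le_of_mulVec_eq_add {d : ℕ}
    {A B : Matrix (Fin d) (Fin d) ℂ} (hA : A.PosSemidef) (hB : B.PosSemidef)
    {x y : Fin d → ℂ} (h : A *ᵥ x = (A + B) *ᵥ y) :
    star y ⬝ᵥ A *ᵥ y ≤ star x ⬝ᵥ A *ᵥ x := by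
  obtain ⟨z, rfl⟩ : ∃ z, x = y + z := ⟨x - y, by abel⟩
  have hz : A *ᵥ z = B *ᵥ y := by
    rwa [mulVec_add, add_mulVec, add_right_inj] at h
  have hzy : star z ⬝ᵥ A *ᵥ y = star y ⬝ᵥ B *ᵥ y := by
    rw [dotProduct_mulVec, ← hA.1.eq, ← star_mulVec, hz, star_mulVec, hB.1.eq,
      ← dotProduct_mulVec]
  have key : star (y + z) ⬝ᵥ A *ᵥ (y + z) =
      star y ⬝ᵥ A *ᵥ y + (star y ⬝ᵥ B *ᵥ y + star y ⬝ᵥ B *ᵥ y + star z ⬝ᵥ A *ᵥ z) := by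
    rw [star_add, mulVec_add, add_dotProduct, dotProduct_add, dotProduct_add, hzy, hz]
    ring
  rw [key]
  have hy := hB.dotProduct_mulVec_nonneg y
  exact le_add_of_nonneg_right (add_nonneg (add_nonneg hy hy) (hA.dotProduct_mulVec_nonneg z))

open scoped ComplexOrder in
/-- Constrained estimators perform better: if `Cθ* = 0`, then the WeaKL estimator penalized
by the constraint `C` has smaller error (at the sample points and in the `M`-norm) than the
unconstrained WeaKL estimator, for arbitrary observations `Yⱼ`. -/
theorem constrained_estimator_performs_better
    (n D d₂ q r p : ℕ) (hn : 1 ≤ n) (hD : 1 ≤ D) (hd₂ : 1 ≤ d₂) (hq : 1 ≤ q) (hr : 1 ≤ r)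
    (hp : 1 ≤ p)
    (Φ : Fin n → Matrix (Fin d₂) (Fin D) ℂ) (Y : Fin n → (Fin d₂ → ℂ))
    (Λ : Matrix (Fin q) (Fin d₂) ℂ) (M : Matrix (Fin r) (Fin D) ℂ)
    (hΛ : Function.Injective Λ.mulVec) (hM : Function.Injective M.mulVec)
    (lam : ℝ) (hlam : 0 ≤ lam)
    (C : Matrix (Fin p) (Fin D) ℂ) (θs : Fin D → ℂ) (hθs : C.mulVec θs = 0)
    (θhat θhatC : Fin D → ℂ)
    (hθhat : θhat =
      ((∑ j, (Φ j)ᴴ * Λᴴ * Λ * Φ j) + (n : ℂ) • (Mᴴ * M))⁻¹.mulVec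
        (∑ j, ((Φ j)ᴴ * Λᴴ * Λ).mulVec (Y j)))
    (hθhatC : θhatC =
      ((∑ j, (Φ j)ᴴ * Λᴴ * Λ * Φ j) + (n : ℂ) • (Mᴴ * M)
          + ((lam : ℂ) * (n : ℂ)) • (Cᴴ * C))⁻¹.mulVec
        (∑ j, ((Φ j)ᴴ * Λᴴ * Λ).mulVec (Y j))) :
    (n : ℝ)⁻¹ * ∑ j, sqnorm (Λ.mulVec ((Φ j).mulVec (θs - θhatC)))
        + sqnorm (M.mulVec (θs - θhatC))
      ≤ (n : ℝ)⁻¹ * ∑ j, sqnorm (Λ.mulVec ((Φ j).mulVec (θs - θhat)))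
        + sqnorm (M.mulVec (θs - θhat)) := by
  have hn0 : (0 : ℝ) < n := by exact_mod_cast hn
  have hform : ∀ j, (Φ j)ᴴ * Λᴴ * Λ * Φ j = (Λ * Φ j)ᴴ * (Λ * Φ j) := fun j => by
    rw [conjTranspose_mul]; simp only [Matrix.mul_assoc]
  have hS : (∑ j, (Φ j)ᴴ * Λᴴ * Λ * Φ j).PosSemidef :=
    posSemidef_sum _ fun j _ => by rw [hform]; exact posSemidef_conjTranspose_mul_self _
  have hM' : ((n : ℂ) • (Mᴴ * M)).PosDef :=
    (PosDef.conjTranspose_mul_self M hM).smul (by exact_mod_cast hn0)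
  have hB : (((lam : ℂ) * (n : ℂ)) • (Cᴴ * C)).PosSemidef :=
    (posSemidef_conjTranspose_mul_self C).smul (by exact_mod_cast mul_nonneg hlam hn0.le)
  set A := (∑ j, (Φ j)ᴴ * Λᴴ * Λ * Φ j) + (n : ℂ) • (Mᴴ * M) with hAdef
  set B := ((lam : ℂ) * (n : ℂ)) • (Cᴴ * C)
  have hA : A.PosDef := PosDef.posSemidef_add hS hM'
  have hAB : (A + B).PosDef := hA.add_posSemidef hB
  have hBθ : B *ᵥ θs = 0 := by simp [B, smul_mulVec, ← mulVec_mulVec, hθs]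
  have hnormal : A *ᵥ (θs - θhat) = (A + B) *ᵥ (θs - θhatC) := by
    rw [mulVec_sub, mulVec_sub, hθhat, hθhatC, mulVec_mulVec, mulVec_mulVec,
      mul_nonsing_inv _ ((isUnit_iff_isUnit_det _).1 hA.isUnit),
      mul_nonsing_inv _ ((isUnit_iff_isUnit_det _).1 hAB.isUnit), add_mulVec A B, hBθ, add_zero]
  have hquad : ∀ v : Fin D → ℂ, star v ⬝ᵥ A *ᵥ v =
      ((∑ j, sqnorm (Λ *ᵥ (Φ j *ᵥ v)) + n * sqnorm (M *ᵥ v) : ℝ) : ℂ) := fun v => by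
    simp only [hAdef, hform, add_mulVec, sum_mulVec, smul_mulVec, dotProduct_add, dotProduct_sum,
      dotProduct_smul, star_dotProduct_conjTranspose_mul_self_mulVec, mulVec_mulVec]
    push_cast
    rfl
  have hle := hA.posSemidef.dotProduct_mulVec_le_of_mulVec_eq_add hB hnormal
  rw [hquad, hquad, Complex.real_le_real] at hle
  have hscale : ∀ a b : ℝ, (n : ℝ)⁻¹ * a + b = (n : ℝ)⁻¹ * (a + n * b) := fun a b => by
    field_simp
  rw [hscale, hscale]
  exact mul_le_mul_of_nonneg_left hle (inv_nonneg.2 hn0.le)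
end

section
/- (WeaKL-T.) Let S ∈ ℂ^{ℓ₁×ℓ₂}, for j = 1,…,n let Φⱼ ∈ ℂ^{ℓ₂×D} and Yⱼ ∈ ℂ^{ℓ₁}, let Λ be an ℓ₁×ℓ₁ diagonal matrix with positive real diagonal entries, let λ ≥ 0, let Π_J ∈ ℂ^{k×D} be any matrix, let P_J ∈ ℂ^{k×k} be Hermitian and idempotent (an orthogonal projection matrix), and let M ∈ ℂ^{r×D} be injective as a linear map. Then the transfer-learning empirical risk L(θ) = (1/n)·Σ_{j=1}^n ‖Λ(SΦⱼθ − Yⱼ)‖₂² + λ‖(I_k − P_J)Π_Jθ‖₂² + ‖Mθ‖₂² has a unique minimizer over ℂ^D, given by θ̂ = (Σ_{j=1}^n Φⱼ*S*Λ*ΛSΦⱼ + nλ·Π_J*(I_k − P_J)Π_J + n·M*M)^{-1} · Σ_{j=1}^n Φⱼ*S*Λ*ΛYⱼ, and the matrix being inverted is invertible. -/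
open Matrix

theorem sqnorm_nonneg {d : ℕ} (x : Fin d → ℂ) : 0 ≤ sqnorm x :=
  Finset.sum_nonneg fun _ _ => sq_nonneg _

theorem eq_zero_of_sqnorm_eq_zero {d : ℕ} {x : Fin d → ℂ} (h : sqnorm x = 0) : x = 0 := by
  funext i
  have := (Finset.sum_eq_zero_iff_of_nonneg fun _ _ => sq_nonneg _).1 h i (Finset.mem_univ i)
  simpa using this

theorem sqnorm_eq_re_dotProduct {d : ℕ} (x : Fin d → ℂ) : sqnorm x = (star x ⬝ᵥ x).re := by
  simp only [sqnorm, dotProduct, Complex.re_sum]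
  refine Finset.sum_congr rfl fun i _ => ?_
  simp [Complex.sq_norm, Complex.normSq_apply]

theorem sqnorm_add {d : ℕ} (x y : Fin d → ℂ) :
    sqnorm (x + y) = sqnorm x + 2 * (star y ⬝ᵥ x).re + sqnorm y := by
  simp only [sqnorm, dotProduct, Complex.re_sum, Finset.mul_sum, ← Finset.sum_add_distrib]
  refine Finset.sum_congr rfl fun i _ => ?_
  simp [Complex.sq_norm, Complex.normSq_apply]
  ring

theorem star_dotProduct_conjTranspose_mulVec {m d : ℕ} (B : Matrix (Fin m) (Fin d) ℂ)
    (h : Fin d → ℂ) (v : Fin m → ℂ) :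
    star h ⬝ᵥ Bᴴ *ᵥ v = star (B *ᵥ h) ⬝ᵥ v := by
  rw [dotProduct_mulVec, star_mulVec]

/-- Unique minimization of a positive definite regularized least-squares functional. -/
theorem regularized_least_squares {n m d k r : ℕ} (hn : 1 ≤ n)
    (B : Fin n → Matrix (Fin m) (Fin d) ℂ) (c : Fin n → Fin m → ℂ)
    (C : Matrix (Fin k) (Fin d) ℂ) (lam : ℝ) (hlam : 0 ≤ lam)
    (M : Matrix (Fin r) (Fin d) ℂ) (hM : Function.Injective M.mulVec)
    (L : (Fin d → ℂ) → ℝ)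
    (hL : ∀ θ, L θ = (n : ℝ)⁻¹ * ∑ j, sqnorm (B j *ᵥ θ - c j)
      + lam * sqnorm (C *ᵥ θ) + sqnorm (M *ᵥ θ))
    (A : Matrix (Fin d) (Fin d) ℂ)
    (hA : A = ∑ j, (B j)ᴴ * B j + ((n : ℂ) * (lam : ℂ)) • (Cᴴ * C) + (n : ℂ) • (Mᴴ * M))
    (θhat : Fin d → ℂ) (hθhat : θhat = A⁻¹ *ᵥ ∑ j, (B j)ᴴ *ᵥ c j) :
    IsUnit A ∧ (∀ θ, L θhat ≤ L θ) ∧ (∀ θ, (∀ θ', L θ ≤ L θ') → θ = θhat) := by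
  have hn0 : (0 : ℝ) < n := by exact_mod_cast hn
  have form (h v : Fin d → ℂ) : (star h ⬝ᵥ A *ᵥ v).re =
      ∑ j, (star (B j *ᵥ h) ⬝ᵥ B j *ᵥ v).re + n * lam * (star (C *ᵥ h) ⬝ᵥ C *ᵥ v).re
        + n * (star (M *ᵥ h) ⬝ᵥ M *ᵥ v).re := by
    simp only [hA, add_mulVec, sum_mulVec, smul_mulVec, ← mulVec_mulVec, dotProduct_add,
      dotProduct_sum, dotProduct_smul, star_dotProduct_conjTranspose_mulVec, Complex.add_re,
      Complex.re_sum, smul_eq_mul]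
    rw [← Complex.ofReal_natCast, ← Complex.ofReal_mul, Complex.re_ofReal_mul,
      Complex.re_ofReal_mul]
  have quad (h : Fin d → ℂ) : (star h ⬝ᵥ A *ᵥ h).re =
      ∑ j, sqnorm (B j *ᵥ h) + n * lam * sqnorm (C *ᵥ h) + n * sqnorm (M *ᵥ h) := by
    simp only [form, sqnorm_eq_re_dotProduct]
  have lower (h : Fin d → ℂ) : n * sqnorm (M *ᵥ h) ≤ (star h ⬝ᵥ A *ᵥ h).re := by
    have h₁ : 0 ≤ ∑ j, sqnorm (B j *ᵥ h) := Finset.sum_nonneg fun _ _ => sqnorm_nonneg _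
    have h₂ : 0 ≤ n * lam * sqnorm (C *ᵥ h) :=
      mul_nonneg (mul_nonneg hn0.le hlam) (sqnorm_nonneg _)
    linarith [quad h]
  have definite (h : Fin d → ℂ) (hh : (star h ⬝ᵥ A *ᵥ h).re ≤ 0) : h = 0 := by
    have h₁ : sqnorm (M *ᵥ h) = 0 := by
      nlinarith [lower h, sqnorm_nonneg (M *ᵥ h)]
    exact hM ((eq_zero_of_sqnorm_eq_zero h₁).trans (mulVec_zero M).symm)
  have hunit : IsUnit A := by
    rw [← mulVec_injective_iff_isUnit]
    intro x y hxy
    have h₁ : A *ᵥ (x - y) = 0 := by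
      rw [mulVec_sub]
      exact sub_eq_zero.2 hxy
    exact sub_eq_zero.1 (definite _ (by simp [h₁]))
  have normal : A *ᵥ θhat = ∑ j, (B j)ᴴ *ᵥ c j := by
    rw [hθhat, mulVec_mulVec, mul_nonsing_inv _ ((isUnit_iff_isUnit_det A).1 hunit), one_mulVec]
  have expand (h : Fin d → ℂ) :
      L (θhat + h) = L θhat + (n : ℝ)⁻¹ * (star h ⬝ᵥ A *ᵥ h).re := by
    have orth : (star h ⬝ᵥ A *ᵥ θhat).re = ∑ j, (star (B j *ᵥ h) ⬝ᵥ c j).re := by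
      simp only [normal, dotProduct_sum, star_dotProduct_conjTranspose_mulVec, Complex.re_sum]
    rw [form] at orth
    have split (j : Fin n) : B j *ᵥ (θhat + h) - c j = (B j *ᵥ θhat - c j) + B j *ᵥ h := by
      rw [mulVec_add]
      abel
    rw [hL, hL, quad]
    simp only [split]
    simp only [mulVec_add, sqnorm_add, dotProduct_sub, Complex.sub_re,
      Finset.sum_add_distrib, ← Finset.mul_sum, Finset.sum_sub_distrib]
    field_simp
    linear_combination 2 * orth
  refine ⟨hunit, fun θ => ?_, fun θ hθ => ?_⟩
  · have h₁ := expand (θ - θhat)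
    rw [add_sub_cancel] at h₁
    have h₂ := (mul_nonneg hn0.le (sqnorm_nonneg _)).trans (lower (θ - θhat))
    have h₃ := mul_nonneg (inv_nonneg.2 hn0.le) h₂
    linarith
  · have h₁ := expand (θ - θhat)
    rw [add_sub_cancel] at h₁
    have h₂ : (n : ℝ)⁻¹ * (star (θ - θhat) ⬝ᵥ A *ᵥ (θ - θhat)).re ≤ 0 := by linarith [hθ θhat]
    exact sub_eq_zero.1 (definite _ (nonpos_of_mul_nonpos_right h₂ (inv_pos.2 hn0)))

/-- WeaKL-T: with `Λ` diagonal with positive real entries, `λ ≥ 0`, `P_J` a Hermitian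
idempotent `k×k` matrix, and `M` injective, the transfer-learning empirical risk
`L(θ) = (1/n)·∑ⱼ ‖Λ(SΦⱼθ − Yⱼ)‖₂² + λ‖(I − P_J)Π_Jθ‖₂² + ‖Mθ‖₂²` has a unique minimizer
`θ̂ = (∑ⱼ Φⱼ*S*Λ*ΛSΦⱼ + nλ·Π_J*(I − P_J)Π_J + n·M*M)⁻¹ ∑ⱼ Φⱼ*S*Λ*ΛYⱼ`,
and the matrix inverted is invertible. -/
theorem weakl_t_unique_minimizer
    (n D r k ℓ₁ ℓ₂ : ℕ) (hn : 1 ≤ n) (hD : 1 ≤ D) (hr : 1 ≤ r) (hk : 1 ≤ k)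
    (hℓ₂ : 1 ≤ ℓ₂) (hℓ : ℓ₂ ≤ ℓ₁)
    (S : Matrix (Fin ℓ₁) (Fin ℓ₂) ℂ)
    (Φ : Fin n → Matrix (Fin ℓ₂) (Fin D) ℂ) (Y : Fin n → (Fin ℓ₁ → ℂ))
    (dΛ : Fin ℓ₁ → ℝ) (hdΛ : ∀ i, 0 < dΛ i)
    (Λ : Matrix (Fin ℓ₁) (Fin ℓ₁) ℂ) (hΛ : Λ = Matrix.diagonal fun i => (dΛ i : ℂ))
    (lam : ℝ) (hlam : 0 ≤ lam)
    (PiJ : Matrix (Fin k) (Fin D) ℂ)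
    (PJ : Matrix (Fin k) (Fin k) ℂ) (hPJ : PJᴴ = PJ) (hPJ2 : PJ * PJ = PJ)
    (M : Matrix (Fin r) (Fin D) ℂ) (hM : Function.Injective M.mulVec)
    (L : (Fin D → ℂ) → ℝ)
    (hL : ∀ θ, L θ =
      (n : ℝ)⁻¹ * ∑ j, sqnorm (Λ.mulVec ((S * Φ j).mulVec θ - Y j))
        + lam * sqnorm (((1 - PJ) * PiJ).mulVec θ)
        + sqnorm (M.mulVec θ))
    (A : Matrix (Fin D) (Fin D) ℂ)
    (hA : A = (∑ j, (Φ j)ᴴ * Sᴴ * Λᴴ * Λ * S * Φ j)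
        + ((n : ℂ) * (lam : ℂ)) • (PiJᴴ * (1 - PJ) * PiJ) + (n : ℂ) • (Mᴴ * M))
    (θhat : Fin D → ℂ)
    (hθhat : θhat = A⁻¹.mulVec (∑ j, ((Φ j)ᴴ * Sᴴ * Λᴴ * Λ).mulVec (Y j))) :
    IsUnit A ∧ (∀ θ, L θhat ≤ L θ) ∧ (∀ θ, (∀ θ', L θ ≤ L θ') → θ = θhat) := by
  have hproj : (1 - PJ)ᴴ * (1 - PJ) = 1 - PJ := by
    rw [conjTranspose_sub, conjTranspose_one, hPJ, mul_sub, mul_one, sub_mul, one_mul, hPJ2,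
      sub_self, sub_zero]
  refine regularized_least_squares hn (fun j => Λ * S * Φ j) (fun j => Λ *ᵥ Y j)
    ((1 - PJ) * PiJ) lam hlam M hM L (fun θ => ?_) A ?_ θhat ?_
  · simp only [hL, mulVec_sub, mulVec_mulVec, Matrix.mul_assoc]
  · have h₁ : ((1 - PJ) * PiJ)ᴴ * ((1 - PJ) * PiJ) = PiJᴴ * (1 - PJ) * PiJ := by
      rw [conjTranspose_mul, Matrix.mul_assoc, ← Matrix.mul_assoc (1 - PJ)ᴴ, hproj,
        Matrix.mul_assoc]
    rw [hA, h₁]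
    simp only [conjTranspose_mul, Matrix.mul_assoc]
  · simp only [hθhat, conjTranspose_mul, mulVec_mulVec, Matrix.mul_assoc]
end
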